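/- For all (λ, t) ∈ ℝ², the Euclidean norm of the cross product of the partial derivatives of r₊ satisfies ‖∂_λ r₊(λ,t) × ∂_t r₊(λ,t)‖² = (a + b − 2λ + (b−a)·cos 2t)² / (2(a+c)(b+c)). Consequently, ∂_λ r₊(λ,t) × ∂_t r₊(λ,t) = 0 if and only if 2λ = a + b + (b−a)·cos 2t; at all such points λ ∈ [b, a], and these points form the cuspidal edges of the curved tetrahedron of Σ₊. The same holds for r₋. -/

import Mathlib

theorem cos_sq_div_add_sin_sq_div_pos {A B : ℝ} (hA : 0 < A) (hB : 0 < B) (t : ℝ) :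
    0 < Real.cos t ^ 2 / A + Real.sin t ^ 2 / B := by
  rcases eq_or_ne (Real.cos t) 0 with h | h
  · have h1 := Real.sin_sq_add_cos_sq t
    have h2 : Real.sin t ^ 2 = 1 := by rw [h] at h1; linarith
    rw [h, h2]; positivity
  · positivity

theorem hasDerivAt_sqrt_cos_sq_div_add_sin_sq_div {A B : ℝ} (hA : 0 < A) (hB : 0 < B) (t : ℝ) :
    HasDerivAt (fun s => √(Real.cos s ^ 2 / A + Real.sin s ^ 2 / B))
      (Real.sin t * Real.cos t * (A - B) /
        (A * B * √(Real.cos t ^ 2 / A + Real.sin t ^ 2 / B))) t := by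
  have hpos : 0 < Real.cos t ^ 2 / A + Real.sin t ^ 2 / B :=
    cos_sq_div_add_sin_sq_div_pos hA hB t
  have hsqrt := Real.sqrt_pos.mpr hpos
  have h := ((((Real.hasDerivAt_cos t).pow 2).div_const A).add
    (((Real.hasDerivAt_sin t).pow 2).div_const B)).sqrt hpos.ne'
  refine h.congr_deriv ?_
  simp only [Pi.add_apply, Pi.pow_apply]
  field_simp
  ring

/- STATEMENT 14: ‖∂_λ r± × ∂_t r±‖² = (a+b−2λ+(b−a)cos 2t)²/(2(a+c)(b+c)); hence the
cross product vanishes iff 2λ = a+b+(b−a)cos 2t, and at such points λ ∈ [b,a] (these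
points form the cuspidal edges of the curved tetrahedron of Σ±). The sign parameter
`sgn` covers both r₊ and r₋. -/
theorem stmt14 (a b c : ℝ) (hab : b < a) (hb : 0 < b) (hc : 0 < c)
    (g : ℝ → ℝ)
    (hg : ∀ t, g t = Real.sqrt (Real.cos t ^ 2 / (a + c) + Real.sin t ^ 2 / (b + c)))
    (sgn : ℝ) (hsgn : sgn = 1 ∨ sgn = -1)
    (r : ℝ → ℝ → ℝ × ℝ × ℝ)
    (hr : ∀ lam t, r lam t =
      ((a - lam) * Real.cos t / Real.sqrt (a + c),
       (b - lam) * Real.sin t / Real.sqrt (b + c),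
       sgn * ((c + lam) * g t)))
    (lam t : ℝ) :
    letI dl : ℝ × ℝ × ℝ :=
      (deriv (fun s => (r s t).1) lam, deriv (fun s => (r s t).2.1) lam,
        deriv (fun s => (r s t).2.2) lam)
    letI dt : ℝ × ℝ × ℝ :=
      (deriv (fun s => (r lam s).1) t, deriv (fun s => (r lam s).2.1) t,
        deriv (fun s => (r lam s).2.2) t)
    letI n : ℝ × ℝ × ℝ :=
      (dl.2.1 * dt.2.2 - dl.2.2 * dt.2.1,
       dl.2.2 * dt.1 - dl.1 * dt.2.2,
       dl.1 * dt.2.1 - dl.2.1 * dt.1)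
    (n.1 ^ 2 + n.2.1 ^ 2 + n.2.2 ^ 2
        = (a + b - 2 * lam + (b - a) * Real.cos (2 * t)) ^ 2 / (2 * (a + c) * (b + c))) ∧
    (n = 0 ↔ 2 * lam = a + b + (b - a) * Real.cos (2 * t)) ∧
    (2 * lam = a + b + (b - a) * Real.cos (2 * t) → lam ∈ Set.Icc b a) := by
  have hA : 0 < a + c := by linarith
  have hB : 0 < b + c := by linarith
  have hC2 := Real.sin_sq_add_cos_sq t
  have hK : a + b - 2 * lam + (b - a) * Real.cos (2 * t) =
      2 * ((b - lam) * Real.cos t ^ 2 + (a - lam) * Real.sin t ^ 2) := by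
    rw [Real.cos_two_mul]
    linear_combination (-2 * a + 2 * lam) * hC2
  have hgt : 0 < Real.cos t ^ 2 / (a + c) + Real.sin t ^ 2 / (b + c) :=
    cos_sq_div_add_sin_sq_div_pos hA hB t
  have hG : 0 < g t := by rw [hg]; exact Real.sqrt_pos.mpr hgt
  have hG2 : g t ^ 2 = Real.cos t ^ 2 / (a + c) + Real.sin t ^ 2 / (b + c) := by
    rw [hg]; exact Real.sq_sqrt hgt.le
  have hdg : HasDerivAt g
      (Real.sin t * Real.cos t * (a - b) / ((a + c) * (b + c) * g t)) t := by
    have h := hasDerivAt_sqrt_cos_sq_div_add_sin_sq_div hA hB t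
    rw [← hg, ← funext hg, add_sub_add_right_eq_sub] at h
    exact h
  have hl1 : deriv (fun s => (r s t).1) lam = -Real.cos t / √(a + c) := by
    simp only [hr]
    refine (((((hasDerivAt_id lam).const_sub a).mul_const _).div_const _).congr_deriv ?_).deriv
    ring
  have hl2 : deriv (fun s => (r s t).2.1) lam = -Real.sin t / √(b + c) := by
    simp only [hr]
    refine (((((hasDerivAt_id lam).const_sub b).mul_const _).div_const _).congr_deriv ?_).deriv
    ring
  have hl3 : deriv (fun s => (r s t).2.2) lam = sgn * g t := by
    simp only [hr]
    refine (((((hasDerivAt_id lam).const_add c).mul_const _).const_mul sgn).congr_deriv ?_).deriv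
    ring
  have ht1 : deriv (fun s => (r lam s).1) t = -((a - lam) * Real.sin t) / √(a + c) := by
    simp only [hr]
    refine ((((Real.hasDerivAt_cos t).const_mul _).div_const _).congr_deriv ?_).deriv
    ring
  have ht2 : deriv (fun s => (r lam s).2.1) t = (b - lam) * Real.cos t / √(b + c) := by
    simp only [hr]
    exact (((Real.hasDerivAt_sin t).const_mul _).div_const _).deriv
  have ht3 : deriv (fun s => (r lam s).2.2) t = sgn * ((c + lam) *
      (Real.sin t * Real.cos t * (a - b) / ((a + c) * (b + c) * g t))) := by
    simp only [hr]
    exact ((hdg.const_mul _).const_mul sgn).deriv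
  simp only [hl1, hl2, hl3, ht1, ht2, ht3]
  have hx := Real.sqrt_pos.mpr hA
  have hy := Real.sqrt_pos.mpr hB
  have hx2 := Real.sq_sqrt hA.le
  have hy2 := Real.sq_sqrt hB.le
  have hs2 : sgn ^ 2 = 1 := by rcases hsgn with h | h <;> simp [h]
  set K := (b - lam) * Real.cos t ^ 2 + (a - lam) * Real.sin t ^ 2 with hKdef
  have hG2' : g t ^ 2 * ((a + c) * (b + c)) =
      Real.cos t ^ 2 * (b + c) + Real.sin t ^ 2 * (a + c) := by
    rw [hG2]; field_simp
  have hn1 : -Real.sin t / √(b + c) * (sgn * ((c + lam) *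
        (Real.sin t * Real.cos t * (a - b) / ((a + c) * (b + c) * g t)))) -
      sgn * g t * ((b - lam) * Real.cos t / √(b + c)) =
      -(sgn * Real.cos t * K / (√(b + c) * g t * (a + c))) := by
    rw [hKdef]
    field_simp
    linear_combination (-(b - lam) * sgn * Real.cos t) * hG2'
  have hn2 : sgn * g t * (-((a - lam) * Real.sin t) / √(a + c)) -
      -Real.cos t / √(a + c) * (sgn * ((c + lam) *
        (Real.sin t * Real.cos t * (a - b) / ((a + c) * (b + c) * g t)))) =
      -(sgn * Real.sin t * K / (√(a + c) * g t * (b + c))) := by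
    rw [hKdef]
    field_simp
    linear_combination (-(a - lam) * sgn * Real.sin t) * hG2'
  have hn3 : -Real.cos t / √(a + c) * ((b - lam) * Real.cos t / √(b + c)) -
      -Real.sin t / √(b + c) * (-((a - lam) * Real.sin t) / √(a + c)) =
      -(K / (√(a + c) * √(b + c))) := by
    rw [hKdef]
    field_simp
    ring
  have hcusp : 2 * lam = a + b + (b - a) * Real.cos (2 * t) ↔ K = 0 := by
    constructor <;> intro h <;> linarith
  rw [hn1, hn2, hn3, hK, hcusp]
  refine ⟨?_, ⟨fun h => ?_, fun h => by simp [h]⟩, fun h => ?_⟩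
  · simp only [neg_sq, div_pow, mul_pow, hx2, hy2, hs2]
    field_simp
    linear_combination (-K ^ 2) * hG2'
  · have h3 := congrArg (fun p : ℝ × ℝ × ℝ => p.2.2) h
    simpa [hx.ne', hy.ne'] using h3
  · rw [← hcusp] at h
    have h1 := mul_nonneg (sub_nonneg.2 hab.le) (sub_nonneg.2 (Real.cos_le_one (2 * t)))
    have h2 := mul_nonneg (sub_nonneg.2 hab.le) (sub_nonneg.2 (Real.neg_one_le_cos (2 * t)))
    constructor <;> linarith
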